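/- arXiv:0708.2752 — 2 statements merged into one kernel-verified Lean document; each statement's English description precedes it below -/
import Mathlib

section
/- The Selmer curve 3x^3 + 4y^3 + 5z^3 = 0 has no rational points over ℚ (other than the trivial (0,0,0)). -/
open NumberField Module

lemma sel_mulmat {K : Type*} [Field K] [NumberField K] (B : Basis (Fin 3) ℚ K) (a : K)
    (ha : a ^ 3 = 6) (hB : ∀ i, B i = a ^ (i : ℕ)) (p q r : ℚ) :
    Algebra.leftMulMatrix B (p • 1 + q • a + r • a ^ 2) =
      !![p, 6 * r, 6 * q; q, p, 6 * r; r, q, p] := by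
  rw [Algebra.leftMulMatrix_apply, ← LinearMap.toMatrix_toLin B B !![p, 6 * r, 6 * q; q, p, 6 * r; r, q, p]]
  congr 1
  apply B.ext
  intro i
  rw [Matrix.toLin_self]
  fin_cases i <;> simp [Fin.sum_univ_three, hB, Algebra.smul_def] <;> grind

lemma sel_norm {K : Type*} [Field K] [NumberField K] (B : Basis (Fin 3) ℚ K) (a : K)
    (ha : a ^ 3 = 6) (hB : ∀ i, B i = a ^ (i : ℕ)) (p q r : ℚ) :
    Algebra.norm ℚ (p • 1 + q • a + r • a ^ 2) = p^3+6*q^3+36*r^3-18*p*q*r := by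
  rw [Algebra.norm_eq_matrix_det B, sel_mulmat B a ha hB, Matrix.det_fin_three]
  simp; ring

lemma sel_trace {K : Type*} [Field K] [NumberField K] (B : Basis (Fin 3) ℚ K) (a : K)
    (ha : a ^ 3 = 6) (hB : ∀ i, B i = a ^ (i : ℕ)) (p q r : ℚ) :
    Algebra.trace ℚ K (p • 1 + q • a + r • a ^ 2) = 3 * p := by
  rw [Algebra.trace_eq_matrix_trace B, sel_mulmat B a ha hB, Matrix.trace_fin_three]
  simp; ring

lemma sel_normZ {K : Type*} [Field K] [NumberField K] (B : Basis (Fin 3) ℚ K) (a : 𝓞 K)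
    (ha : a ^ 3 = 6) (hB : ∀ i, B i = (a : K) ^ (i : ℕ)) (p q r : ℤ) :
    Algebra.norm ℤ ((p : 𝓞 K) + q * a + r * a ^ 2) = p^3+6*q^3+36*r^3-18*p*q*r := by
  have ha' : (a : K) ^ 3 = 6 := by
    have := congrArg (algebraMap (𝓞 K) K) ha
    rw [map_pow] at this
    exact this.trans (map_ofNat _ 6)
  have := sel_norm B a ha' hB p q r
  have h2 := Algebra.coe_norm_int ((p : 𝓞 K) + (q : 𝓞 K) * a + (r : 𝓞 K) * a ^ 2)
  have h3 : (((p : 𝓞 K) + q * a + r * a ^ 2 : 𝓞 K) : K) = (p:ℚ) • 1 + (q:ℚ) • (a:K) + (r:ℚ) • (a:K) ^ 2 := by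
    simp [Algebra.smul_def]
  rw [h3, this] at h2
  exact_mod_cast h2

lemma sel_traceZ {K : Type*} [Field K] [NumberField K] (B : Basis (Fin 3) ℚ K) (a : 𝓞 K)
    (ha : a ^ 3 = 6) (hB : ∀ i, B i = (a : K) ^ (i : ℕ)) (p q r : ℤ) :
    Algebra.trace ℤ (𝓞 K) ((p : 𝓞 K) + q * a + r * a ^ 2) = 3 * p := by
  have ha' : (a : K) ^ 3 = 6 := by
    have := congrArg (algebraMap (𝓞 K) K) ha
    rw [map_pow] at this
    exact this.trans (map_ofNat _ 6)
  have := sel_trace B a ha' hB p q r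
  have h2 := Algebra.coe_trace_int ((p : 𝓞 K) + (q : 𝓞 K) * a + (r : 𝓞 K) * a ^ 2)
  have h3 : (((p : 𝓞 K) + q * a + r * a ^ 2 : 𝓞 K) : K) = (p:ℚ) • 1 + (q:ℚ) • (a:K) + (r:ℚ) • (a:K) ^ 2 := by
    simp [Algebra.smul_def]
  rw [h3, this] at h2
  exact_mod_cast h2

lemma sel_discr {K : Type*} [Field K] [NumberField K] (B : Basis (Fin 3) ℚ K) (a : 𝓞 K)
    (ha : a ^ 3 = 6) (hB : ∀ i, B i = (a : K) ^ (i : ℕ)) : |discr K| ≤ 972 := by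
  have hfr : finrank ℤ (𝓞 K) = 3 := by
    rw [RingOfIntegers.rank, finrank_eq_card_basis B]; rfl
  let b : Basis (Fin 3) ℤ (𝓞 K) := finBasisOfFinrankEq ℤ (𝓞 K) hfr
  let v : Fin 3 → 𝓞 K := fun i => a ^ (i : ℕ)
  have h1 : Algebra.discr ℤ v = -972 := by
    have e0 := sel_traceZ B a ha hB 1 0 0
    have e1 := sel_traceZ B a ha hB 0 1 0
    have e2 := sel_traceZ B a ha hB 0 0 1
    have e3 := sel_traceZ B a ha hB 6 0 0
    have e4 := sel_traceZ B a ha hB 0 6 0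
    have f3 : a * a ^ 2 = 6 := by rw [← ha]; ring
    have f3' : a ^ 2 * a = 6 := by rw [← ha]; ring
    have f4 : a ^ 2 * a ^ 2 = 6 * a := by rw [← ha]; ring
    simp at e0 e1 e2 e3 e4
    rw [Algebra.discr_def, Matrix.det_fin_three]
    simp [Algebra.traceMatrix_apply, Algebra.traceForm_apply, v, f3, f3', f4, e0, e1, e2, e3, e4, ← pow_two]
  have h2 : Algebra.discr ℤ v = (b.toMatrix v).det ^ 2 * discr K := by
    rw [← discr_eq_discr K b, ← Algebra.discr_of_matrix_vecMul]
    congr 1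
    ext i
    conv_lhs => rw [← b.sum_repr (v i)]
    simp [Matrix.vecMul, dotProduct, Basis.toMatrix_apply, mul_comm]
  rw [h1] at h2
  have h3 : discr K ∣ 972 := ⟨-(b.toMatrix v).det ^ 2, by linarith⟩
  have := Int.le_of_dvd (by norm_num) ((abs_dvd _ _).2 h3)
  exact this

lemma sel_places {K : Type*} [Field K] [NumberField K] (B : Basis (Fin 3) ℚ K) (a : K)
    (ha : a ^ 3 = 6) (hB : ∀ i, B i = a ^ (i : ℕ)) :
    InfinitePlace.nrComplexPlaces K = 1 ∧ InfinitePlace.nrRealPlaces K = 1 := by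
  have hfr : finrank ℚ K = 3 := by rw [finrank_eq_card_basis B]; rfl
  have h1 := InfinitePlace.card_add_two_mul_card_eq_rank K
  rw [hfr] at h1
  classical
  have h2 : InfinitePlace.nrRealPlaces K ≤ 1 := by
    rw [← InfinitePlace.card_real_embeddings, Fintype.card_le_one_iff]
    rintro ⟨φ, hφ⟩ ⟨ψ, hψ⟩
    have key : ∀ φ : K →+* ℂ, ComplexEmbedding.IsReal φ → ∃ t : ℝ, t ^ 3 = 6 ∧ φ a = t := by
      intro φ hφ
      refine ⟨(hφ.embedding a), ?_, (hφ.coe_embedding_apply a).symm⟩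
      rw [← map_pow, ha]; exact map_ofNat _ 6
    obtain ⟨t, ht, h⟩ := key φ hφ
    obtain ⟨s, hs, h'⟩ := key ψ hψ
    have hts : t = s := by
      apply (Odd.strictMono_pow (n := 3) (by decide)).injective
      simp [ht, hs]
    ext x
    show φ x = ψ x
    have : φ.toRatAlgHom.toLinearMap = ψ.toRatAlgHom.toLinearMap := by
      apply B.ext
      intro i
      simp [hB, h, h', hts]
    exact LinearMap.congr_fun this x
  omega

lemma sel_prime_principal {R : Type*} [CommRing R] [IsDedekindDomain R] [Module.Free ℤ R] [Module.Finite ℤ R] (P : Ideal R)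
    (g : R) (hg : g ∈ P) (hn : (Algebra.norm ℤ g).natAbs.Prime) (h0 : P ≠ ⊤) :
    Submodule.IsPrincipal P := by
  have hd : P ∣ Ideal.span {g} := Ideal.dvd_span_singleton.2 hg
  have : Ideal.span {g} = P := by
    obtain ⟨J, hJ⟩ := hd
    have h1 := congrArg Ideal.absNorm hJ
    rw [Ideal.absNorm_span_singleton, map_mul] at h1
    have h2 : Ideal.absNorm J = 1 := by
      rw [h1] at hn
      rcases Nat.prime_mul_iff.1 hn with ⟨_, h⟩ | ⟨_, h⟩
      · exact h
      · exact absurd (Ideal.absNorm_eq_one_iff.1 h) h0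
    rw [Ideal.absNorm_eq_one_iff] at h2
    rw [hJ, h2, Ideal.mul_top]
  exact ⟨g, this.symm⟩

lemma sel_res {R : Type*} [CommRing R] [IsDedekindDomain R] [Module.Free ℤ R] [Module.Finite ℤ R] (P : Ideal R)
    (p : ℕ) [Fact p.Prime] (hp : Ideal.absNorm P = p) (a : R) :
    ∃ n : ℕ, n < p ∧ a - n ∈ P := by
  have hc : Nat.card (R ⧸ P) = p := by rw [← hp]; rfl
  have : Nontrivial (R ⧸ P) := by
    have := (Fact.out : p.Prime).one_lt
    rw [← hc] at this
    have := Nat.finite_of_card_ne_zero (by omega : Nat.card (R ⧸ P) ≠ 0)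
    rwa [Finite.one_lt_card_iff_nontrivial] at *
  have : Finite (R ⧸ P) := Nat.finite_of_card_ne_zero (by rw [hc]; exact (Fact.out : p.Prime).ne_zero)
  have : Fintype (R ⧸ P) := Fintype.ofFinite _
  let e := ZMod.ringEquivOfPrime (R ⧸ P) (Fact.out : p.Prime) (by rw [← Nat.card_eq_fintype_card, hc])
  refine ⟨(e.symm (Ideal.Quotient.mk P a)).val, ZMod.val_lt _, ?_⟩
  rw [← Ideal.Quotient.eq_zero_iff_mem, map_sub, map_natCast]
  have : ((((e.symm (Ideal.Quotient.mk P a)).val : ℕ) : ZMod p)) = e.symm (Ideal.Quotient.mk P a) := by simp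
  have h := congrArg e this
  rw [map_natCast, e.apply_symm_apply] at h
  rw [h, sub_self]

open scoped Real in
lemma sel_pid {K : Type*} [Field K] [NumberField K] (B : Basis (Fin 3) ℚ K) (a : 𝓞 K)
    (ha : a ^ 3 = 6) (hB : ∀ i, B i = (a : K) ^ (i : ℕ)) : IsPrincipalIdealRing (𝓞 K) := by
  have ha' : (a : K) ^ 3 = 6 := by
    have := congrArg (algebraMap (𝓞 K) K) ha
    rw [map_pow] at this
    exact this.trans (map_ofNat _ 6)
  have hfr : finrank ℚ K = 3 := by rw [finrank_eq_card_basis B]; rfl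
  have hM : ⌊(4 / π) ^ InfinitePlace.nrComplexPlaces K *
      ((finrank ℚ K).factorial / (finrank ℚ K) ^ (finrank ℚ K) * √|discr K|)⌋₊ ≤ 8 := by
    rw [(sel_places B a ha' hB).1, hfr]
    apply Nat.le_of_lt_succ
    rw [Nat.floor_lt (by positivity)]
    have h1 : √|discr K| ≤ 31.2 := by
      rw [Real.sqrt_le_left (by norm_num)]
      have : ((|discr K| : ℤ) : ℝ) ≤ 972 := by exact_mod_cast sel_discr B a ha hB
      push_cast at this
      linarith
    have h2 : 4 / π ≤ 4 / 3.14 := by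
      gcongr; exact Real.pi_gt_d2.le
    have h3 : ((3 : ℕ).factorial : ℝ) = 6 := by norm_num [Nat.factorial]
    rw [h3]
    calc (4 / π) ^ 1 * (6 / (3 : ℕ) ^ 3 * √|discr K|) ≤ (4 / 3.14) ^ 1 * (6 / (3 : ℕ) ^ 3 * 31.2) := by gcongr
      _ < _ := by norm_num
  apply RingOfIntegers.isPrincipalIdealRing_of_isPrincipal_of_pow_le_of_mem_primesOver_of_mem_Icc
  intro p hp hpp P hP hle
  have hp8 : p ≤ 8 := (Finset.mem_Icc.1 hp).2.trans hM
  have hle8 := hle.trans hM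
  obtain ⟨hP1, hP2⟩ := hP
  have hpP : (p : 𝓞 K) ∈ P := by
    have : (p : ℤ) ∈ Ideal.span {(p : ℤ)} := Ideal.mem_span_singleton_self _
    rw [hP2.over, Ideal.mem_comap] at this
    simpa using this
  have hPtop : P ≠ ⊤ := hP1.ne_top
  have hPbot : P ≠ ⊥ := by
    rintro rfl
    rw [Ideal.mem_bot] at hpP
    exact hpp.ne_zero (by exact_mod_cast hpP)
  have hmax : P.IsMaximal := hP1.isMaximal hPbot
  have hmax2 : (Ideal.span {(p : ℤ)}).IsMaximal := 
    (Nat.prime_iff_prime_int.mp hpp).isMaximal_span_singleton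
  have hnorm : p ^ P.inertiaDeg ℤ = Ideal.absNorm P := Ideal.pow_inertiaDeg p P 
  have hfpos : 0 < P.inertiaDeg ℤ := Ideal.inertiaDeg_pos ..
  have hnt : Nontrivial (𝓞 K ⧸ P) := Ideal.Quotient.nontrivial_iff.2 hPtop
  have hpow : ∀ n, a ^ n ∈ P → a ∈ P := fun n h => hP1.mem_of_pow_mem n h
  have mem2 : ∀ p q r : ℤ, (Algebra.norm ℤ ((p : 𝓞 K) + (q : 𝓞 K) * a + (r : 𝓞 K) * a ^ 2)).natAbs.Prime →
      (p : 𝓞 K ⧸ P) + q * (Ideal.Quotient.mk P a) + r * (Ideal.Quotient.mk P a) ^ 2 = 0 →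
      Submodule.IsPrincipal P := by
    intro p q r h1 h2
    refine sel_prime_principal P _ ?_ h1 hPtop
    rw [← Ideal.Quotient.eq_zero_iff_mem]
    simpa using h2
  have q3 : (Ideal.Quotient.mk P a) ^ 3 = 6 := by rw [← map_pow, ha]; exact map_ofNat _ 6
  have qp : (p : 𝓞 K ⧸ P) = 0 := by
    rw [← Ideal.Quotient.eq_zero_iff_mem] at hpP
    simpa using hpP
  have hres : P.inertiaDeg ℤ = 1 → ∃ n : ℕ, n < p ∧ Ideal.Quotient.mk P a = n := by
    intro h
    have : Fact p.Prime := ⟨hpp⟩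
    obtain ⟨n, hn, hn'⟩ := sel_res P p (by rw [← hnorm, h, pow_one]) a
    refine ⟨n, hn, ?_⟩
    rw [← Ideal.Quotient.eq_zero_iff_mem] at hn'
    simpa [sub_eq_zero] using hn'
  have hP23 : p ∣ 6 → Ideal.Quotient.mk P a = 0 := by
    rintro ⟨k, hk⟩
    rw [Ideal.Quotient.eq_zero_iff_mem]
    apply hpow 3
    rw [ha]
    have : (6 : 𝓞 K) = p * k := by exact_mod_cast congrArg (Nat.cast (R := 𝓞 K)) hk
    rw [this]
    exact P.mul_mem_right _ hpP
  have hf1 : 5 ≤ p → P.inertiaDeg ℤ = 1 := by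
    intro h5
    by_contra h
    have : 2 ≤ P.inertiaDeg ℤ := by omega
    have h25 : p ^ 2 ≤ p ^ P.inertiaDeg ℤ := Nat.pow_le_pow_right (by omega) this
    nlinarith
  have h01 : (0 : 𝓞 K ⧸ P) ≠ 1 := zero_ne_one
  generalize Ideal.Quotient.mk P a = x at *
  interval_cases p
  · exact absurd hpp (by norm_num)
  · exact absurd hpp (by norm_num)
  · have := hP23 (by norm_num)
    apply mem2 2 (-1) 0
    · rw [sel_normZ B a ha hB]; norm_num
    · push_cast at *; rw [this]; linear_combination qp
  · have := hP23 (by norm_num)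
    apply mem2 3 2 1
    · rw [sel_normZ B a ha hB]; norm_num
    · push_cast at *; rw [this]; linear_combination qp
  · exact absurd hpp (by norm_num)
  · obtain ⟨n, hn, hx⟩ := hres (hf1 (by norm_num))
    apply mem2 (-1) 1 0
    · rw [sel_normZ B a ha hB]; norm_num
    · push_cast at *
      interval_cases n <;> push_cast at * <;> grind
  · exact absurd hpp (by norm_num)
  · obtain ⟨n, hn, hx⟩ := hres (hf1 (by norm_num))
    have hn : n = 3 ∨ n = 5 ∨ n = 6 := by
      push_cast at *
      interval_cases n <;> push_cast at * <;> grind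
    rcases hn with rfl | rfl | rfl
    · apply mem2 (-5) 1 1
      · rw [sel_normZ B a ha hB]; norm_num
      · push_cast at *; rw [hx]; linear_combination qp
    · apply mem2 (-7) 2 1
      · rw [sel_normZ B a ha hB]; norm_num
      · push_cast at *; rw [hx]; linear_combination 4 * qp
    · apply mem2 1 1 0
      · rw [sel_normZ B a ha hB]; norm_num
      · push_cast at *; rw [hx]; linear_combination qp
  · exact absurd hpp (by norm_num)

lemma sel_units {K : Type*} [Field K] [NumberField K] (B : Basis (Fin 3) ℚ K) (a : 𝓞 K)
    (ha : a ^ 3 = 6) (hB : ∀ i, B i = (a : K) ^ (i : ℕ)) (e : (𝓞 K)ˣ)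
    (he : ∀ w : (𝓞 K)ˣ, e ≠ w ^ 3) (u : (𝓞 K)ˣ) :
    ∃ j : ℕ, j < 3 ∧ ∃ w : (𝓞 K)ˣ, u = e ^ j * w ^ 3 := by
  have ha' : (a : K) ^ 3 = 6 := by
    have := congrArg (algebraMap (𝓞 K) K) ha
    rw [map_pow] at this
    exact this.trans (map_ofNat _ 6)
  have hfr : finrank ℚ K = 3 := by rw [finrank_eq_card_basis B]; rfl
  have hrank : Units.rank K = 1 := by
    obtain ⟨h1, h2⟩ := sel_places B a ha' hB
    unfold Units.rank
    rw [InfinitePlace.card_eq_nrRealPlaces_add_nrComplexPlaces, h1, h2]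
  let i0 : Fin (Units.rank K) := ⟨0, by omega⟩
  have huniv : (Finset.univ : Finset (Fin (Units.rank K))) = {i0} := by
    ext i
    simp only [Finset.mem_univ, Finset.mem_singleton, true_iff]
    apply Fin.ext
    have := i.2
    simp only [i0]; omega
  have key : ∃ η : (𝓞 K)ˣ, ∀ u : (𝓞 K)ˣ, ∃ n : ℤ, ∃ w : (𝓞 K)ˣ, u = η ^ n * w ^ 3 := by
    refine ⟨Units.fundSystem K i0, fun u => ?_⟩
    obtain ⟨⟨ζ, f⟩, hζ, -⟩ := Units.exist_unique_eq_mul_prod K u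
    refine ⟨f i0, ζ, ?_⟩
    have h3 : (ζ : (𝓞 K)ˣ) ^ 3 = ζ := by
      rcases Units.torsion_eq_one_or_neg_one_of_odd_finrank (by rw [hfr]; decide) ζ with h | h
      · rw [h]; simp
      · rw [h]; ext; push_cast; ring
    rw [h3, hζ, huniv, Finset.prod_singleton, mul_comm]
  obtain ⟨η, hη⟩ := key
  obtain ⟨m, v, hm⟩ := hη e
  obtain ⟨n, w, hn⟩ := hη u
  have hm3 : ¬ (3 : ℤ) ∣ m := by
    rintro ⟨k, rfl⟩
    apply he (η ^ k * v)
    rw [hm, mul_pow, ← zpow_natCast (η ^ k), ← zpow_mul]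
    congr 2
    push_cast; ring
  obtain ⟨j, hj, k, hk⟩ : ∃ j : ℕ, j < 3 ∧ ∃ k : ℤ, n = j * m + 3 * k := by
    have hm1 : m % 3 = 1 ∨ m % 3 = 2 := by omega
    have hn1 : n % 3 = 0 ∨ n % 3 = 1 ∨ n % 3 = 2 := by omega
    have : n % 3 = 0 ∨ (n - m) % 3 = 0 ∨ (n - 2 * m) % 3 = 0 := by
      rcases hm1 with h | h <;> rcases hn1 with h' | h' | h' <;> omega
    rcases this with h | h | h
    · exact ⟨0, by norm_num, n / 3, by push_cast; omega⟩
    · exact ⟨1, by norm_num, (n - m) / 3, by push_cast; omega⟩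
    · exact ⟨2, by norm_num, (n - 2 * m) / 3, by push_cast; omega⟩
  obtain ⟨s, hs⟩ : ∃ s : (𝓞 K)ˣ, v ^ j * s = 1 := ⟨(v ^ j)⁻¹, mul_inv_cancel _⟩
  have hz : η ^ n = (η ^ m) ^ j * (η ^ k) ^ 3 := by
    rw [hk, zpow_add, mul_comm (j : ℤ) m, zpow_mul, zpow_natCast, mul_comm (3 : ℤ) k, zpow_mul]
    norm_cast
  refine ⟨j, hj, η ^ k * w * s, ?_⟩
  rw [hn, hm, hz]
  generalize η ^ m = H
  generalize η ^ k = G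
  calc H ^ j * G ^ 3 * w ^ 3 = H ^ j * G ^ 3 * w ^ 3 * (v ^ j * s) ^ 3 := by rw [hs]; simp
    _ = _ := by
      apply Units.ext; push_cast; ring

lemma sel_not_cube_aux {S : Type*} [CommRing S] (n : ℕ) (hn : n < 7) (h7 : (7 : S) = 0)
    (h01 : (0 : S) ≠ 1) (h2 : (1 : S) - 6 * -1 + 3 * (-1) ^ 2 = (n : S) ^ 3) : False := by
  apply h01
  interval_cases n <;> push_cast at h2
  · linear_combination (2) * h2 - (3) * h7
  · linear_combination (3) * h2 - (4) * h7
  · linear_combination (3) * h2 - (1) * h7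
  · linear_combination (-2) * h2 - (5) * h7
  · linear_combination (3) * h2 - (-23) * h7
  · linear_combination (-2) * h2 - (33) * h7
  · linear_combination (-2) * h2 - (59) * h7

lemma sel_not_cube {K : Type*} [Field K] [NumberField K] (B : Basis (Fin 3) ℚ K) (a : 𝓞 K)
    (ha : a ^ 3 = 6) (hB : ∀ i, B i = (a : K) ^ (i : ℕ)) (w : 𝓞 K) :
    1 - 6 * a + 3 * a ^ 2 ≠ w ^ 3 := by
  intro h
  obtain ⟨P, hP⟩ : ∃ P : Ideal (𝓞 K), P = Ideal.span {1 + a} := ⟨_, rfl⟩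
  have hN : Ideal.absNorm P = 7 := by
    have := sel_normZ B a ha hB 1 1 0
    simp at this
    rw [hP, Ideal.absNorm_span_singleton, this]; rfl
  have : Fact (Nat.Prime 7) := ⟨by norm_num⟩
  obtain ⟨n, hn, hw⟩ := sel_res P 7 hN w
  have hnt : Nontrivial (𝓞 K ⧸ P) := by
    rw [Ideal.Quotient.nontrivial_iff]
    intro h
    rw [h] at hN
    simp at hN
  have h1 : (1 : 𝓞 K ⧸ P) + Ideal.Quotient.mk P a = 0 := by
    have : (1 + a) ∈ P := by rw [hP]; exact Ideal.mem_span_singleton_self _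
    rw [← Ideal.Quotient.eq_zero_iff_mem] at this
    simpa using this
  have h2 := congrArg (Ideal.Quotient.mk P) h
  rw [← Ideal.Quotient.eq_zero_iff_mem] at hw
  have q3 : (Ideal.Quotient.mk P a) ^ 3 = 6 := by rw [← map_pow, ha]; exact map_ofNat _ 6
  have q6 : (Ideal.Quotient.mk P 6) = 6 := map_ofNat _ 6
  have q3' : (Ideal.Quotient.mk P 3) = 3 := map_ofNat _ 3
  simp only [map_sub, map_add, map_mul, map_pow, map_one, map_natCast, q6, q3'] at h2 hw
  have h01 : (0 : 𝓞 K ⧸ P) ≠ 1 := zero_ne_one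
  generalize Ideal.Quotient.mk P a = x at *
  generalize Ideal.Quotient.mk P w = y at *
  have hx : x = -1 := by linear_combination h1
  have hy : y = n := by linear_combination hw
  have h7 : (7 : 𝓞 K ⧸ P) = 0 := by rw [hx] at q3; linear_combination -q3
  rw [hx, hy] at h2
  clear hx hy h1 hw q3 q6 q3'
  exact sel_not_cube_aux n hn h7 h01 h2

lemma sel_prim (x y z : ℚ) (h : ¬ (x = 0 ∧ y = 0 ∧ z = 0)) :
    ∃ (t : ℚ) (a b c : ℤ), t ≠ 0 ∧ t * x = a ∧ t * y = b ∧ t * z = c ∧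
      ∀ p : ℕ, p.Prime → ¬ ((p : ℤ) ∣ a ∧ (p : ℤ) ∣ b ∧ (p : ℤ) ∣ c) := by
  have hx := x.den_ne_zero
  have hy := y.den_ne_zero
  have hz := z.den_ne_zero
  have ex : x.den * x = x.num := Rat.den_mul_eq_num x
  have ey : y.den * y = y.num := Rat.den_mul_eq_num y
  have ez : z.den * z = z.num := Rat.den_mul_eq_num z
  obtain ⟨a, ha⟩ : ∃ a : ℤ, ((x.den * y.den * z.den : ℕ) : ℚ) * x = a :=
    ⟨y.den * z.den * x.num, by push_cast; rw [← ex]; ring⟩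
  obtain ⟨b, hb⟩ : ∃ a : ℤ, ((x.den * y.den * z.den : ℕ) : ℚ) * y = a :=
    ⟨x.den * z.den * y.num, by push_cast; rw [← ey]; ring⟩
  obtain ⟨c, hc⟩ : ∃ a : ℤ, ((x.den * y.den * z.den : ℕ) : ℚ) * z = a :=
    ⟨x.den * y.den * z.num, by push_cast; rw [← ez]; ring⟩
  have hD : ((x.den * y.den * z.den : ℕ) : ℚ) ≠ 0 := by
    exact_mod_cast mul_ne_zero (mul_ne_zero hx hy) hz
  generalize ((x.den * y.den * z.den : ℕ) : ℚ) = D at *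
  let g : ℕ := Nat.gcd a.natAbs (Nat.gcd b.natAbs c.natAbs)
  have hg : g ≠ 0 := by
    intro h0
    apply h
    simp only [g, Nat.gcd_eq_zero_iff, Int.natAbs_eq_zero] at h0
    obtain ⟨h1, h2, h3⟩ := h0
    subst h1 h2 h3
    simp [hD] at ha hb hc
    exact ⟨ha, hb, hc⟩
  have hgq : (g : ℚ) ≠ 0 := by exact_mod_cast hg
  obtain ⟨a', ha'⟩ : (g : ℤ) ∣ a := Int.natCast_dvd.2 (Nat.gcd_dvd_left _ _)
  obtain ⟨b', hb'⟩ : (g : ℤ) ∣ b := Int.natCast_dvd.2 ((Nat.gcd_dvd_right _ _).trans (Nat.gcd_dvd_left _ _))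
  obtain ⟨c', hc'⟩ : (g : ℤ) ∣ c := Int.natCast_dvd.2 ((Nat.gcd_dvd_right _ _).trans (Nat.gcd_dvd_right _ _))
  have ha2 : (a : ℚ) = g * a' := by exact_mod_cast ha'
  have hb2 : (b : ℚ) = g * b' := by exact_mod_cast hb'
  have hc2 : (c : ℚ) = g * c' := by exact_mod_cast hc'
  refine ⟨D / g, a', b', c', div_ne_zero hD hgq, ?_, ?_, ?_, ?_⟩
  · field_simp; linear_combination ha + ha2
  · field_simp; linear_combination hb + hb2
  · field_simp; linear_combination hc + hc2
  · rintro p hp ⟨⟨k1, h1⟩, ⟨k2, h2⟩, ⟨k3, h3⟩⟩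
    have : g * p ∣ g := by
      refine Nat.dvd_gcd ?_ (Nat.dvd_gcd ?_ ?_)
      · rw [← Int.natCast_dvd]; exact ⟨k1, by rw [ha', h1]; push_cast; ring⟩
      · rw [← Int.natCast_dvd]; exact ⟨k2, by rw [hb', h2]; push_cast; ring⟩
      · rw [← Int.natCast_dvd]; exact ⟨k3, by rw [hc', h3]; push_cast; ring⟩
    have h5 := Nat.le_of_dvd (Nat.pos_of_ne_zero hg) this
    have := hp.two_le
    have := Nat.pos_of_ne_zero hg
    nlinarith

lemma sel_threeadic (p q r a b c : ℤ) (hr : ¬ (3 : ℤ) ∣ r)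
    (h : p * (3 * a ^ 2 * c + 3 * a * b ^ 2 + 18 * b * c ^ 2)
      + q * (3 * a ^ 2 * b + 18 * a * c ^ 2 + 18 * b ^ 2 * c)
      + r * (a ^ 3 + 6 * b ^ 3 + 36 * c ^ 3 + 36 * a * b * c) = 0) :
    (3 : ℤ) ∣ a ∧ (3 : ℤ) ∣ b ∧ (3 : ℤ) ∣ c := by
  have h3 : Prime (3 : ℤ) := Int.prime_three
  have key : ∀ t : ℤ, (3 : ℤ) ∣ r * t ^ 3 → (3 : ℤ) ∣ t := fun t ht =>
    h3.dvd_of_dvd_pow ((h3.dvd_or_dvd ht).resolve_left hr)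
  obtain ⟨a', rfl⟩ : (3 : ℤ) ∣ a := by
    apply key
    refine ⟨-(p * (a ^ 2 * c + a * b ^ 2 + 6 * b * c ^ 2)
      + q * (a ^ 2 * b + 6 * a * c ^ 2 + 6 * b ^ 2 * c)
      + r * (2 * b ^ 3 + 12 * c ^ 3 + 12 * a * b * c)), ?_⟩
    linear_combination h
  obtain ⟨b', rfl⟩ : (3 : ℤ) ∣ b := by
    apply key
    refine ⟨r * b ^ 3 + (p * (3 * a' ^ 2 * c + a' * b ^ 2 + 2 * b * c ^ 2)
      + q * (3 * a' ^ 2 * b + 6 * a' * c ^ 2 + 2 * b ^ 2 * c)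
      + r * (3 * a' ^ 3 + 4 * c ^ 3 + 12 * a' * b * c)), ?_⟩
    linarith
  refine ⟨⟨a', rfl⟩, ⟨b', rfl⟩, ?_⟩
  apply key
  refine ⟨-(p * (a' ^ 2 * c + 3 * a' * b' ^ 2 + 2 * b' * c ^ 2)
      + q * (3 * a' ^ 2 * b' + 2 * a' * c ^ 2 + 6 * b' ^ 2 * c)
      + r * (a' ^ 3 + 6 * b' ^ 3 + c ^ 3 + 12 * a' * b' * c)), ?_⟩
  linarith

lemma sel_coprime (x y z : ℤ) (h : 3 * x ^ 3 + 4 * y ^ 3 + 5 * z ^ 3 = 0)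
    (hp : ∀ p : ℕ, p.Prime → ¬ ((p : ℤ) ∣ x ∧ (p : ℤ) ∣ y ∧ (p : ℤ) ∣ z)) :
    IsCoprime z (6 * x * y) ∧ (5 : ℤ) ∣ 2 * y + x := by
  constructor
  · rw [Int.isCoprime_iff_gcd_eq_one]
    by_contra hg
    obtain ⟨p, hpp, hpd⟩ := Nat.exists_prime_and_dvd hg
    have hP : Prime (p : ℤ) := Nat.prime_iff_prime_int.1 hpp
    have hz : (p : ℤ) ∣ z := (Int.natCast_dvd_natCast.2 hpd).trans (Int.gcd_dvd_left _ _)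
    have hm : (p : ℤ) ∣ 6 * x * y := (Int.natCast_dvd_natCast.2 hpd).trans (Int.gcd_dvd_right _ _)
    have p2 : (p : ℤ) ∣ 2 → p = 2 := fun h => 
      (Nat.prime_dvd_prime_iff_eq hpp Nat.prime_two).1 (by exact_mod_cast h)
    have p3 : (p : ℤ) ∣ 3 → p = 3 := fun h => 
      (Nat.prime_dvd_prime_iff_eq hpp Nat.prime_three).1 (by exact_mod_cast h)
    have c2 : ∀ t u s: ℤ, 3 * t ^ 3 + 4 * s ^ 3 + 5 * u ^ 3 = 0 → (2:ℤ) ∣ u → (2:ℤ) ∣ t ∧ (2:ℤ) ∣ s := by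
      rintro t u s h ⟨v, rfl⟩
      have e : (2 : ℤ) ∣ t := by
        apply Int.prime_two.dvd_of_dvd_pow (n := 3)
        exact ⟨-t ^ 3 - 2 * s ^ 3 - 20 * v ^ 3, by linarith⟩ 
      refine ⟨e, ?_⟩
      obtain ⟨w, rfl⟩ := e
      apply Int.prime_two.dvd_of_dvd_pow (n := 3)
      exact ⟨-3 * w ^ 3 - 5 * v ^ 3, by linarith⟩
    have c3 : ∀ t u s: ℤ, 3 * t ^ 3 + 4 * s ^ 3 + 5 * u ^ 3 = 0 → (3:ℤ) ∣ u → (3:ℤ) ∣ t ∧ (3:ℤ) ∣ s := by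
      rintro t u s h ⟨v, rfl⟩
      have e : (3 : ℤ) ∣ s := by
        apply Int.prime_three.dvd_of_dvd_pow (n := 3)
        exact ⟨-t ^ 3 - s ^ 3 - 45 * v ^ 3, by linarith⟩ 
      refine ⟨?_, e⟩
      obtain ⟨w, rfl⟩ := e
      apply Int.prime_three.dvd_of_dvd_pow (n := 3)
      exact ⟨-12 * w ^ 3 - 15 * v ^ 3, by linarith⟩
    have n2 : p ≠ 2 := by
      rintro rfl
      obtain ⟨h1, h2⟩ := c2 x z y h (by exact_mod_cast hz)
      exact hp 2 hpp ⟨by exact_mod_cast h1, by exact_mod_cast h2, hz⟩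
    have n3 : p ≠ 3 := by
      rintro rfl
      obtain ⟨h1, h2⟩ := c3 x z y h (by exact_mod_cast hz)
      exact hp 3 hpp ⟨by exact_mod_cast h1, by exact_mod_cast h2, hz⟩
    have m2 : ¬ (p : ℤ) ∣ 2 := fun h => n2 (p2 h)
    have m3 : ¬ (p : ℤ) ∣ 3 := fun h => n3 (p3 h)
    have hxy : (p : ℤ) ∣ x ∧ (p : ℤ) ∣ y := by
      rcases hP.dvd_or_dvd hm with hm | hy
      · rcases hP.dvd_or_dvd hm with hm | hx
        · rcases hP.dvd_or_dvd (show (p : ℤ) ∣ 2 * 3 from hm) with h | h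
          · exact absurd h m2
          · exact absurd h m3
        · refine ⟨hx, ?_⟩
          obtain ⟨u, rfl⟩ := hx
          obtain ⟨v, rfl⟩ := hz
          have : (p : ℤ) ∣ 2 * (2 * y ^ 3) := ⟨-3 * p ^ 2 * u ^ 3 - 5 * p ^ 2 * v ^ 3, by linarith⟩
          exact hP.dvd_of_dvd_pow ((hP.dvd_or_dvd ((hP.dvd_or_dvd this).resolve_left m2)).resolve_left m2)
      · refine ⟨?_, hy⟩
        obtain ⟨u, rfl⟩ := hy
        obtain ⟨v, rfl⟩ := hz
        have : (p : ℤ) ∣ 3 * x ^ 3 := ⟨-4 * p ^ 2 * u ^ 3 - 5 * p ^ 2 * v ^ 3, by linarith⟩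
        exact hP.dvd_of_dvd_pow ((hP.dvd_or_dvd this).resolve_left m3)
    exact hp p hpp ⟨hxy.1, hxy.2, hz⟩
  · have h5 : (3 : ZMod 5) * (x : ZMod 5) ^ 3 + 4 * (y : ZMod 5) ^ 3 = 0 := by
      have := congrArg (Int.cast : ℤ → ZMod 5) h
      push_cast at this
      have h50 : (5 : ZMod 5) = 0 := rfl
      rw [h50] at this
      linear_combination this
    have : ((2 * y + x : ℤ) : ZMod 5) = 0 := by
      push_cast
      generalize (x : ZMod 5) = X at *
      generalize (y : ZMod 5) = Y at *
      revert X Y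
      decide
    exact (ZMod.intCast_zmod_eq_zero_iff_dvd _ 5).1 this

lemma sel_id1 {R : Type*} [CommRing R] (a k y x : R) (ha : a ^ 3 = 6) (hx : x = 5 * k - 2 * y) :
    2 * y + x * a = (2 - a) * (a - 1) * ((a ^ 2 + a + 1) * (k + x + y) + (a + 3) * (x + y)) := by
  subst hx
  linear_combination (y - 7 * k - a * y + 6 * a * k) * ha

lemma sel_id2 {R : Type*} [CommRing R] (a k y x : R) (ha : a ^ 3 = 6) (hx : x = 5 * k - 2 * y) :
    (2 * y) ^ 2 - 2 * y * x * a + x ^ 2 * a ^ 2 =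
      (2 - a) ^ 2 * (a ^ 2 + a + 1) * (109 + 60 * a + 33 * a ^ 2) *
        (45*k^2-30*k*y+4*y^2+(-15*k^2+14*k*y-2*y^2)*a+(-5*k^2+k*y)*a^2) := by
  subst hx
  linear_combination ((290)*y^2 + (-2180)*k*y + (3270)*k^2 + (14)*a*y^2 + (-181)*a*k*y
    + (710)*a*k^2 + (80)*a^2*y^2 + (-569)*a^2*k*y + (840)*a^2*k^2 + (-210)*a^3*y^2
    + (1574)*a^3*k*y + (-2260)*a^3*k^2 + (66)*a^4*y^2 + (-423)*a^4*k*y + (300)*a^4*k^2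
    + (-33)*a^5*k*y + (165)*a^5*k^2) * ha

lemma sel_id3 {R : Type*} [CommRing R] (a k y x : R) (ha : a ^ 3 = 6) (hx : x = 5 * k - 2 * y) :
    10 * (((a ^ 2 + a + 1) * (k + x + y) + (a + 3) * (x + y)) *
      (45*k^2-30*k*y+4*y^2+(-15*k^2+14*k*y-2*y^2)*a+(-5*k^2+k*y)*a^2)) = 8 * y ^ 3 + 6 * x ^ 3 := by
  subst hx
  linear_combination ((20)*y^3 + (-280)*k*y^2 + (1200)*k^2*y + (-1450)*k^3 + (-10)*a*k*y^2
    + (110)*a*k^2*y + (-300)*a*k^3) * ha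

lemma sel_cube {K : Type*} [Field K] [NumberField K] (B : Basis (Fin 3) ℚ K) (a : 𝓞 K)
    (ha : a ^ 3 = 6) (hB : ∀ i, B i = (a : K) ^ (i : ℕ)) (x y z : ℤ)
    (h : 3 * x ^ 3 + 4 * y ^ 3 + 5 * z ^ 3 = 0)
    (hp : ∀ p : ℕ, p.Prime → ¬ ((p : ℤ) ∣ x ∧ (p : ℤ) ∣ y ∧ (p : ℤ) ∣ z)) :
    ∃ j : ℕ, j < 3 ∧ ∃ g : 𝓞 K, 2 * (y : 𝓞 K) + x * a =
      (1 - 6 * a + 3 * a ^ 2) ^ j * ((2 - a) * (a - 1)) * g ^ 3 := by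
  obtain ⟨hc, k, hk⟩ := sel_coprime x y z h hp
  have hx : (x : 𝓞 K) = 5 * (k : 𝓞 K) - 2 * (y : 𝓞 K) := by
    have : x = 5 * k - 2 * y := by linarith
    rw [this]; push_cast; ring
  have hR : 3 * (x : 𝓞 K) ^ 3 + 4 * (y : 𝓞 K) ^ 3 + 5 * (z : 𝓞 K) ^ 3 = 0 := by exact_mod_cast h
  have hcR : IsCoprime (z : 𝓞 K) (6 * x * y) := by
    have := hc.intCast (R := 𝓞 K)
    push_cast at this
    exact this
  have hpid := sel_pid B a ha hB
  have i1 := sel_id1 a (k : 𝓞 K) y x ha hx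
  have i2 := sel_id2 a (k : 𝓞 K) y x ha hx
  have i3 := sel_id3 a (k : 𝓞 K) y x ha hx
  generalize ((a ^ 2 + a + 1) * ((k : 𝓞 K) + x + y) + (a + 3) * (x + y)) = Bv at *
  generalize (45*(k : 𝓞 K)^2-30*k*y+4*(y : 𝓞 K)^2+(-15*(k : 𝓞 K)^2+14*k*y-2*(y : 𝓞 K)^2)*a+(-5*(k : 𝓞 K)^2+k*y)*a^2) = E at *
  have hBE : Bv * E = (-(z : 𝓞 K)) ^ 3 := by
    have h10 : (10 : 𝓞 K) ≠ 0 := by norm_num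
    apply mul_left_cancel₀ h10
    rw [i3]
    linear_combination 2 * hR
  have hcop : IsCoprime Bv E := by
    apply IsRelPrime.isCoprime
    intro d hd1 hd2
    have d1 : d ∣ 6 * x * y * a := by
      have e1 : d ∣ 2 * (y : 𝓞 K) + x * a := i1 ▸ Dvd.dvd.mul_left hd1 _
      have e2 : d ∣ (2 * (y : 𝓞 K)) ^ 2 - 2 * y * x * a + (x : 𝓞 K) ^ 2 * a ^ 2 := i2 ▸ Dvd.dvd.mul_left hd2 _
      have := dvd_sub (e1.mul_left (2 * (y : 𝓞 K) + x * a)) e2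
      have e : (2 * (y : 𝓞 K) + x * a) * (2 * (y : 𝓞 K) + x * a) - ((2 * (y : 𝓞 K)) ^ 2 - 2 * y * x * a + (x : 𝓞 K) ^ 2 * a ^ 2) = 6 * x * y * a := by ring
      rwa [e] at this
    have d2 : d ∣ (z : 𝓞 K) ^ 3 := by
      have : d ∣ (-(z : 𝓞 K)) ^ 3 := hBE ▸ Dvd.dvd.mul_left hd2 _
      rwa [Odd.neg_pow (by decide), dvd_neg] at this
    have hza : IsCoprime (z : 𝓞 K) a := by
      have : IsCoprime (z : 𝓞 K) (a ^ 3) := by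
        rw [ha]
        apply hcR.of_isCoprime_of_dvd_right
        exact ⟨x * y, by ring⟩
      exact (IsCoprime.pow_right_iff (by norm_num)).1 this
    have := (hcR.mul_right hza).pow_left (m := 3)
    exact this.isUnit_of_dvd' d2 d1
  obtain ⟨b, u, hu⟩ := exists_associated_pow_of_mul_eq_pow' hcop hBE
  have hee : (1 - 6 * a + 3 * a ^ 2) * (109 + 60 * a + 33 * a ^ 2) = 1 := by
    linear_combination (-18 + 99 * a) * ha
  obtain ⟨j, hj, w, hw⟩ := sel_units B a ha hB (Units.mkOfMulEqOne _ _ hee) (by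
    intro w hw
    apply sel_not_cube B a ha hB w
    have := congrArg Units.val hw
    simpa using this) u
  refine ⟨j, hj, w * b, ?_⟩
  rw [i1, ← hu, hw]
  push_cast
  rw [Units.val_mkOfMulEqOne]
  ring

lemma sel_coef {K : Type*} [Field K] [NumberField K] (B : Basis (Fin 3) ℚ K) (a : K)
    (hB : ∀ i, B i = a ^ (i : ℕ)) (p q r : ℚ) 
    (h : (p : K) + q * a + r * a ^ 2 = 0) : p = 0 ∧ q = 0 ∧ r = 0 := by
  have := Fintype.linearIndependent_iff.1 B.linearIndependent ![p, q, r] (by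
    simp [Fin.sum_univ_three, hB, Algebra.smul_def]
    exact h)
  exact ⟨this 0, this 1, this 2⟩

lemma sel_final {K : Type*} [Field K] [NumberField K] (B : Basis (Fin 3) ℚ K) (a : 𝓞 K)
    (ha : a ^ 3 = 6) (hB : ∀ i, B i = (a : K) ^ (i : ℕ)) (x y z : ℤ)
    (h : 3 * x ^ 3 + 4 * y ^ 3 + 5 * z ^ 3 = 0)
    (hp : ∀ p : ℕ, p.Prime → ¬ ((p : ℤ) ∣ x ∧ (p : ℤ) ∣ y ∧ (p : ℤ) ∣ z)) : False := by
  obtain ⟨j, hj, g, hg⟩ := sel_cube B a ha hB x y z h hp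
  have ha' : (a : K) ^ 3 = 6 := by
    have := congrArg (algebraMap (𝓞 K) K) ha
    rw [map_pow] at this
    exact this.trans (map_ofNat _ 6)
  obtain ⟨p, q, r, hr, hpqr⟩ : ∃ p q r : ℤ, ¬ (3 : ℤ) ∣ r ∧
      (1 - 6 * a + 3 * a ^ 2) ^ j * ((2 - a) * (a - 1)) = p + q * a + r * a ^ 2 := by
    interval_cases j
    · exact ⟨-2, 3, -1, by decide, by push_cast; ring⟩
    · exact ⟨88, -3, -25, by decide, by push_cast; linear_combination (15 - 3 * a) * ha⟩
    · exact ⟨934, -981, 257, by decide, by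
        push_cast; linear_combination (156 - 168 * a + 63 * a ^ 2 - 9 * a ^ 3) * ha⟩
  rw [hpqr] at hg
  have hgK := congrArg (algebraMap (𝓞 K) K) hg
  simp only [map_add, map_mul, map_pow, map_intCast, map_ofNat] at hgK
  obtain ⟨b, c, d, hbcd⟩ : ∃ b c d : ℚ, (g : K) = b + c * a + d * (a : K) ^ 2 := by
    refine ⟨B.repr g 0, B.repr g 1, B.repr g 2, ?_⟩
    conv_lhs => rw [← B.sum_repr (g : K)]
    simp [Fin.sum_univ_three, hB, Algebra.smul_def]
  change 2 * (y : K) + x * (a : K) = (p + q * (a : K) + r * (a : K) ^ 2) * (g : K) ^ 3 at hgK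
  rw [hbcd] at hgK
  generalize (a : K) = A at *
  have hxyz : ¬ (x = 0 ∧ y = 0) := by
    rintro ⟨rfl, rfl⟩
    have hz : z = 0 := by simpa using h
    exact hp 2 Nat.prime_two (by simp [hz])
  have hcf := sel_coef B A hB
    ((p * (b^3+6*c^3+36*d^3+36*b*c*d) + 6 * q * (3*b^2*d+3*b*c^2+18*c*d^2)
      + 6 * r * (3*b^2*c+18*b*d^2+18*c^2*d)) - 2 * y)
    ((p * (3*b^2*c+18*b*d^2+18*c^2*d) + q * (b^3+6*c^3+36*d^3+36*b*c*d)
      + 6 * r * (3*b^2*d+3*b*c^2+18*c*d^2)) - x)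
    (p * (3*b^2*d+3*b*c^2+18*c*d^2) + q * (3*b^2*c+18*b*d^2+18*c^2*d)
      + r * (b^3+6*c^3+36*d^3+36*b*c*d)) (by
    push_cast
    generalize (b : K) = b at *
    generalize (c : K) = c at *
    generalize (d : K) = d at *
    have e : (b + c * A + d * A ^ 2) ^ 3 = (b^3+6*c^3+36*d^3+36*b*c*d)
        + (3*b^2*c+18*b*d^2+18*c^2*d) * A + (3*b^2*d+3*b*c^2+18*c*d^2) * A ^ 2 := by
      linear_combination (6*d^3 + c^3 + 6*b*c*d + 3*A*c^2*d + 3*A*b*d^2 + 3*A^2*c*d^2 + A^3*d^3) * ha'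
    rw [e] at hgK
    generalize (b^3+6*c^3+36*d^3+36*b*c*d) = C0 at *
    generalize (3*b^2*c+18*b*d^2+18*c^2*d) = C1 at *
    generalize (3*b^2*d+3*b*c^2+18*c*d^2) = C2 at *
    linear_combination -hgK - (q * C2 + r * C1 + A * r * C2) * ha')
  obtain ⟨h0, h1, h2⟩ := hcf
  have hb : ¬ (b = 0 ∧ c = 0 ∧ d = 0) := by
    rintro ⟨rfl, rfl, rfl⟩
    apply hxyz
    simp at h0 h1
    exact ⟨h1, h0⟩
  obtain ⟨t, b', c', d', ht, e1, e2, e3, hprim⟩ := sel_prim b c d hb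
  have := sel_threeadic p q r b' c' d' hr (by
    have : (p * (3 * (b' : ℚ) ^ 2 * d' + 3 * b' * (c' : ℚ) ^ 2 + 18 * c' * (d' : ℚ) ^ 2)
      + q * (3 * (b' : ℚ) ^ 2 * c' + 18 * b' * (d' : ℚ) ^ 2 + 18 * (c' : ℚ) ^ 2 * d')
      + r * ((b' : ℚ) ^ 3 + 6 * (c' : ℚ) ^ 3 + 36 * (d' : ℚ) ^ 3 + 36 * b' * c' * d') : ℚ) = 0 := by
      rw [← e1, ← e2, ← e3]
      linear_combination t ^ 3 * h2
    exact_mod_cast this)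
  exact hprim 3 Nat.prime_three (by exact_mod_cast this)

lemma sel_field : ∃ (K : Type) (_ : Field K) (_ : NumberField K) (B : Basis (Fin 3) ℚ K) (a : 𝓞 K),
    a ^ 3 = 6 ∧ ∀ i, B i = (a : K) ^ (i : ℕ) := by
  have hirr : Irreducible (Polynomial.X ^ 3 - Polynomial.C 6 : Polynomial ℚ) := by
    apply X_pow_sub_C_irreducible_of_prime Nat.prime_three
    intro b hb
    have hv := congrArg (padicValRat 2) hb
    have : Fact (Nat.Prime 2) := ⟨Nat.prime_two⟩
    have hb0 : b ≠ 0 := by rintro rfl; norm_num at hb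
    rw [padicValRat.pow] at hv
    have h6 : padicValRat 2 6 = 1 := by
      rw [show (6 : ℚ) = 2 * 3 by norm_num, padicValRat.mul (by norm_num) (by norm_num)]
      have h2 : padicValRat 2 2 = 1 := by exact_mod_cast padicValRat.self (p := 2) (by norm_num)
      have h3 : padicValRat 2 3 = 0 := by
        have := padicValRat.of_nat (p := 2) (n := 3)
        rw [padicValNat.eq_zero_of_not_dvd (by norm_num)] at this
        exact_mod_cast this
      rw [h2, h3]; rfl
    rw [h6] at hv
    push_cast at hv
    omega
  have : Fact (Irreducible (Polynomial.X ^ 3 - Polynomial.C 6 : Polynomial ℚ)) := ⟨hirr⟩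
  have hdeg : (Polynomial.X ^ 3 - Polynomial.C 6 : Polynomial ℚ).natDegree = 3 := 
    Polynomial.natDegree_X_pow_sub_C
  let pb := AdjoinRoot.powerBasis hirr.ne_zero
  have hfin : FiniteDimensional ℚ (AdjoinRoot (Polynomial.X ^ 3 - Polynomial.C 6 : Polynomial ℚ)) := pb.finite
  have hnf : NumberField (AdjoinRoot (Polynomial.X ^ 3 - Polynomial.C 6 : Polynomial ℚ)) := ⟨⟩
  have hr : (AdjoinRoot.root (Polynomial.X ^ 3 - Polynomial.C 6 : Polynomial ℚ)) ^ 3 = 6 := by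
    have := AdjoinRoot.eval₂_root (Polynomial.X ^ 3 - Polynomial.C 6 : Polynomial ℚ)
    simp [sub_eq_zero] at this
    exact this
  have hdim : pb.dim = 3 := by simp [pb, hdeg]
  refine ⟨_, inferInstance, hnf, pb.basis.reindex (finCongr hdim), 
    ⟨AdjoinRoot.root _, Polynomial.X ^ 3 - Polynomial.C 6, Polynomial.monic_X_pow_sub_C _ (by norm_num), by simp [hr]⟩, ?_, ?_⟩
  · ext
    exact hr
  · intro i
    simp [pb]
    rfl

/-- The Selmer curve `3x³ + 4y³ + 5z³ = 0` has no rational points over `ℚ`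
(other than the trivial `(0,0,0)`). -/
theorem selmer_curve_no_rational_points (x y z : ℚ)
    (h : 3 * x ^ 3 + 4 * y ^ 3 + 5 * z ^ 3 = 0) :
    x = 0 ∧ y = 0 ∧ z = 0 := by
  by_contra hne
  obtain ⟨t, a, b, c, ht, e1, e2, e3, hprim⟩ := sel_prim x y z hne
  obtain ⟨K, _, _, B, α, hα, hB⟩ := sel_field
  refine sel_final B α hα hB a b c ?_ hprim
  have : 3 * (a : ℚ) ^ 3 + 4 * (b : ℚ) ^ 3 + 5 * (c : ℚ) ^ 3 = 0 := by
    rw [← e1, ← e2, ← e3]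
    linear_combination t ^ 3 * h
  exact_mod_cast this
end

section
/- The subring of k[r,s] invariant under the k-algebra automorphism σ with σ(r)=s and σ(s)=-r-s is generated by a = r²+rs+s², b = -3rs(r+s), and c = r³+3r²s-s³, and these satisfy the relation a³ = b² + bc + c². -/
open MvPolynomial

/-- Let `k` be a field of characteristic not `2` or `3`, and let `σ` be the `k`-algebra
automorphism of `k[r,s]` with `σ(r) = s` and `σ(s) = -r - s` (so `σ` has order `3`).
The subring of `k[r,s]` invariant under `σ` is generated as a `k`-algebra by
`a = r² + rs + s²`, `b = -3rs(r+s)` and `c = r³ + 3r²s - s³`, and these satisfy the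
relation `a³ = b² + bc + c²`. -/
theorem invariant_subring_generators (k : Type*) [Field k]
    (h2 : (2 : k) ≠ 0) (h3 : (3 : k) ≠ 0) :
    let r : MvPolynomial (Fin 2) k := X 0
    let s : MvPolynomial (Fin 2) k := X 1
    let σ : MvPolynomial (Fin 2) k →ₐ[k] MvPolynomial (Fin 2) k := aeval ![s, -r - s]
    let a := r ^ 2 + r * s + s ^ 2
    let b := -3 * (r * s * (r + s))
    let c := r ^ 3 + 3 * r ^ 2 * s - s ^ 3
    AlgHom.equalizer σ (AlgHom.id k (MvPolynomial (Fin 2) k)) =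
      Algebra.adjoin k {a, b, c} ∧ a ^ 3 = b ^ 2 + b * c + c ^ 2 := by
  intro r s σ a b c
  refine ⟨?_, by simp only [a, b, c]; ring⟩
  have hσr : σ r = s := by simp [σ, r]
  have hσs : σ s = -r - s := by simp [σ, s]
  have hle : Algebra.adjoin k {a, b, c} ≤
      AlgHom.equalizer σ (AlgHom.id k (MvPolynomial (Fin 2) k)) := by
    refine Algebra.adjoin_le ?_
    rintro x (rfl | rfl | rfl)
    · change σ a = a
      simp only [a, map_add, map_mul, map_pow, hσr, hσs]; ring
    · change σ b = b
      simp only [b, map_add, map_mul, map_neg, map_ofNat, hσr, hσs]; ring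
    · change σ c = c
      simp only [c, map_add, map_sub, map_mul, map_pow, map_ofNat, hσr, hσs]; ring
  refine le_antisymm ?_ hle
  set A := Algebra.adjoin k {a, b, c} with hA
  have ha : a ∈ A := Algebra.subset_adjoin (by simp)
  have hb : b ∈ A := Algebra.subset_adjoin (by simp)
  have hc : c ∈ A := Algebra.subset_adjoin (by simp)
  have hC : ∀ z : k, (C z : MvPolynomial (Fin 2) k) ∈ A := fun z => A.algebraMap_mem z
  have h33 : (C (3⁻¹ : k) : MvPolynomial (Fin 2) k) * 3 = 1 := by
    have : (3 : MvPolynomial (Fin 2) k) = C 3 := (map_ofNat C 3).symm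
    rw [this, ← C_mul, inv_mul_cancel₀ h3, C_1]
  obtain ⟨d, hd, hdA⟩ : ∃ d, d = -(r * s * (r + s)) ∧ d ∈ A := by
    refine ⟨C (3⁻¹ : k) * b, ?_, A.mul_mem (hC _) hb⟩
    simp only [b]
    linear_combination (-(r * s * (r + s))) * h33
  have key : ∀ f : MvPolynomial (Fin 2) k, ∃ p0 ∈ A, ∃ p1 ∈ A, ∃ p2 ∈ A, ∃ p3 ∈ A,
      ∃ p4 ∈ A, ∃ p5 ∈ A, f = p0 + p1 * r + p2 * r ^ 2 + p3 * s + p4 * (r * s)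
        + p5 * (r ^ 2 * s) := by
    intro f
    induction f using MvPolynomial.induction_on with
    | C z =>
      exact ⟨C z, hC z, 0, A.zero_mem, 0, A.zero_mem, 0, A.zero_mem, 0, A.zero_mem,
        0, A.zero_mem, by ring⟩
    | add f g hf hg =>
      obtain ⟨p0, h0, p1, h1, p2, h2, p3, h3, p4, h4, p5, h5, e⟩ := hf
      obtain ⟨q0, g0, q1, g1, q2, g2, q3, g3, q4, g4, q5, g5, e'⟩ := hg
      exact ⟨_, A.add_mem h0 g0, _, A.add_mem h1 g1, _, A.add_mem h2 g2, _, A.add_mem h3 g3,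
        _, A.add_mem h4 g4, _, A.add_mem h5 g5, by rw [e, e']; ring⟩
    | mul_X f i hf =>
      obtain ⟨p0, h0, p1, h1, p2, h2, p3, h3, p4, h4, p5, h5, e⟩ := hf
      fin_cases i
      · refine ⟨p2 * d, A.mul_mem h2 hdA, p0 + p2 * a, A.add_mem h0 (A.mul_mem h2 ha), p1, h1,
          p5 * d, A.mul_mem h5 hdA, p3 + p5 * a, A.add_mem h3 (A.mul_mem h5 ha), p4, h4, ?_⟩
        change f * r = _
        rw [e, hd]; simp only [a]; ring
      · refine ⟨p3 * a - p4 * d, A.sub_mem (A.mul_mem h3 ha) (A.mul_mem h4 hdA),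
          -(p5 * d), A.neg_mem (A.mul_mem h5 hdA), -p3, A.neg_mem h3,
          p0 - p5 * d, A.sub_mem h0 (A.mul_mem h5 hdA),
          p1 - p3 - p5 * a, A.sub_mem (A.sub_mem h1 h3) (A.mul_mem h5 ha),
          p2 - p4, A.sub_mem h2 h4, ?_⟩
        change f * s = _
        rw [e, hd]; simp only [a]; ring
  intro f hf
  have hf1 : σ f = f := hf
  obtain ⟨p0, m0, p1, m1, p2, m2, p3, m3, p4, m4, p5, m5, e⟩ := key f
  have i0 : σ p0 = p0 := hle m0
  have i1 : σ p1 = p1 := hle m1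
  have i2 : σ p2 = p2 := hle m2
  have i3 : σ p3 = p3 := hle m3
  have i4 : σ p4 = p4 := hle m4
  have i5 : σ p5 = p5 := hle m5
  have e1 := congrArg σ e
  simp only [map_add, map_mul, map_pow, hσr, hσs, i0, i1, i2, i3, i4, i5, hf1] at e1
  have e2 := congrArg σ e1
  simp only [map_add, map_sub, map_neg, map_mul, map_pow, hσr, hσs, i0, i1, i2, i3, i4, i5,
    hf1] at e2
  have hfin : f = p0 + C (3⁻¹ : k) * ((p2 + p2 - p4) * a + p5 * c) := by
    have h3f : 3 * f = 3 * p0 + ((p2 + p2 - p4) * a + p5 * c) := by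
      simp only [a, c]
      linear_combination e + e1 + e2
    linear_combination C (3⁻¹ : k) * h3f - (f - p0) * h33
  rw [hfin]
  exact A.add_mem m0 (A.mul_mem (hC _) (A.add_mem (A.mul_mem (A.sub_mem (A.add_mem m2 m2) m4) ha)
    (A.mul_mem m5 hc)))
end
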